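/- arXiv:1801.00380 — 5 statements merged into one kernel-verified Lean document; each statement's English description precedes it below -/
import Mathlib

section
/- Let Σ be a positive definite real p×p matrix whose eigenvalues all lie in the interval [θ₁, θ₂] with 0 < θ₁ ≤ θ₂ < ∞, and let Σ = L D Lᵀ be its modified Cholesky decomposition. Then every diagonal entry d_j of D satisfies θ₁ ≤ d_j ≤ θ₂. -/
open Matrix

theorem mcd_quad_aux {p : ℕ} (S : Matrix (Fin p) (Fin p) ℝ) (hS : S.IsHermitian)
    (x : Fin p → ℝ) : ∃ y : Fin p → ℝ,
      x ⬝ᵥ (S *ᵥ x) = ∑ i, hS.eigenvalues i * (y i) ^ 2 ∧ x ⬝ᵥ x = ∑ i, (y i) ^ 2 := by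
  have hsp := hS.spectral_theorem
  rw [Unitary.conjStarAlgAut_apply] at hsp
  have hW : (hS.eigenvectorUnitary : Matrix (Fin p) (Fin p) ℝ) *
      (star hS.eigenvectorUnitary : Matrix (Fin p) (Fin p) ℝ) = 1 :=
    Unitary.coe_mul_star_self _
  set e := hS.eigenvalues
  generalize (hS.eigenvectorUnitary : Matrix (Fin p) (Fin p) ℝ) = W at hsp hW
  have hstar : star W = Wᵀ := by
    rw [star_eq_conjTranspose, conjTranspose_eq_transpose_of_trivial]
  rw [hstar] at hsp hW
  have hq : ∀ v : Fin p → ℝ, x ⬝ᵥ (W *ᵥ v) = (Wᵀ *ᵥ x) ⬝ᵥ v := by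
    intro v
    rw [dotProduct_mulVec, mulVec_transpose]
  refine ⟨Wᵀ *ᵥ x, ?_, ?_⟩
  · rw [hsp, ← mulVec_mulVec, ← mulVec_mulVec, hq]
    generalize Wᵀ *ᵥ x = y
    simp only [dotProduct, mulVec_diagonal]
    refine Finset.sum_congr rfl fun i _ => ?_
    simp
    ring
  · have : x ⬝ᵥ x = x ⬝ᵥ ((W * Wᵀ) *ᵥ x) := by rw [hW, one_mulVec]
    rw [this, ← mulVec_mulVec, hq]
    simp only [dotProduct, sq]

/-- Let `S` be a positive definite real `p × p` matrix whose eigenvalues all lie in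
`[θ₁, θ₂]` with `0 < θ₁ ≤ θ₂`, and let `S = L * D * Lᵀ` be its modified Cholesky
decomposition.  Then every diagonal entry `D j j` satisfies `θ₁ ≤ D j j ≤ θ₂`. -/
theorem mcd_diag_entry_bounds {p : ℕ} (S L D : Matrix (Fin p) (Fin p) ℝ) (θ₁ θ₂ : ℝ)
    (hθ₁ : 0 < θ₁) (hθ : θ₁ ≤ θ₂)
    (hS : S.PosDef)
    (heig : ∀ i : Fin p, θ₁ ≤ hS.1.eigenvalues i ∧ hS.1.eigenvalues i ≤ θ₂)
    (hLlow : ∀ i j : Fin p, i < j → L i j = 0)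
    (hLdiag : ∀ i : Fin p, L i i = 1)
    (hDoff : ∀ i j : Fin p, i ≠ j → D i j = 0)
    (hDpos : ∀ i : Fin p, 0 < D i i)
    (hdecomp : S = L * D * Lᵀ) :
    ∀ j : Fin p, θ₁ ≤ D j j ∧ D j j ≤ θ₂ := by
  have hD : D = diagonal (fun i => D i i) := by
    ext i j
    by_cases hij : i = j
    · subst hij; simp
    · simp [hij, hDoff i j hij]
  have hquad : ∀ x : Fin p → ℝ,
      x ⬝ᵥ (S *ᵥ x) = ∑ k, D k k * ((Lᵀ *ᵥ x) k) ^ 2 := by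
    intro x
    rw [hdecomp, ← mulVec_mulVec, ← mulVec_mulVec, dotProduct_mulVec, ← mulVec_transpose]
    generalize Lᵀ *ᵥ x = y
    rw [hD]
    simp only [dotProduct, mulVec_diagonal, diagonal_apply_eq]
    exact Finset.sum_congr rfl fun i _ => by ring
  have hub : ∀ x : Fin p → ℝ, x ⬝ᵥ (S *ᵥ x) ≤ θ₂ * (x ⬝ᵥ x) := by
    intro x
    obtain ⟨y, h1, h2⟩ := mcd_quad_aux S hS.1 x
    rw [h1, h2, Finset.mul_sum]
    exact Finset.sum_le_sum fun i _ => mul_le_mul_of_nonneg_right (heig i).2 (sq_nonneg _)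
  have hlb : ∀ x : Fin p → ℝ, θ₁ * (x ⬝ᵥ x) ≤ x ⬝ᵥ (S *ᵥ x) := by
    intro x
    obtain ⟨y, h1, h2⟩ := mcd_quad_aux S hS.1 x
    rw [h1, h2, Finset.mul_sum]
    exact Finset.sum_le_sum fun i _ => mul_le_mul_of_nonneg_right (heig i).1 (sq_nonneg _)
  have htri : BlockTriangular Lᵀ id := fun i j hij => hLlow j i hij
  have hdet : Lᵀ.det = 1 := by
    rw [det_of_upperTriangular htri]
    simp [hLdiag]
  have hunit : IsUnit Lᵀ.det := by rw [hdet]; exact isUnit_one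
  haveI : Invertible Lᵀ := invertibleOfIsUnitDet _ hunit
  have hinv := blockTriangular_inv_of_blockTriangular htri
  have hmul : Lᵀ * (Lᵀ)⁻¹ = 1 := mul_nonsing_inv _ hunit
  generalize (Lᵀ)⁻¹ = V at hinv hmul
  intro j
  constructor
  · have hVj : V j j = 1 := by
      have h := congrFun (congrFun hmul j) j
      rw [mul_apply, one_apply_eq, Finset.sum_eq_single j] at h
      · simpa [hLdiag] using h
      · intro k _ hk
        rcases lt_or_gt_of_ne hk with h' | h'
        · rw [htri (show id k < id j from h'), zero_mul]
        · rw [hinv (show id j < id k from h'), mul_zero]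
      · simp
    have h := hlb (V *ᵥ Pi.single j 1)
    rw [hquad, mulVec_mulVec, hmul, one_mulVec, Finset.sum_eq_single j] at h
    · have h1 : 1 ≤ (V *ᵥ Pi.single j 1) ⬝ᵥ (V *ᵥ Pi.single j 1) := by
        rw [mulVec_single_one]
        have := Finset.single_le_sum (f := fun i => V i j * V i j)
          (fun i _ => mul_self_nonneg _) (Finset.mem_univ j)
        simpa [dotProduct, hVj] using this
      simp at h
      simp at h1
      nlinarith
    · intro k _ hk
      simp [hk]
    · simp
  · have h := hub (Pi.single j 1)
    rw [hquad] at h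
    have h1 := Finset.single_le_sum (f := fun k => D k k * ((Lᵀ *ᵥ Pi.single j 1) k) ^ 2)
          (fun i _ => mul_nonneg (hDpos i).le (sq_nonneg _)) (Finset.mem_univ j)
    simp [hLdiag] at h h1
    linarith
end

section
/- Let Σ be a positive definite real p×p matrix whose eigenvalues all lie in the interval [θ₁, θ₂] with 0 < θ₁ ≤ θ₂ < ∞, and let Σ = L D Lᵀ be its modified Cholesky decomposition. Then every singular value σ of L satisfies √(θ₁/θ₂) ≤ σ ≤ √(θ₂/θ₁); that is, θ₁/θ₂ · I ⪯ L Lᵀ ⪯ θ₂/θ₁ · I in the Loewner order. -/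
open Matrix

lemma mcd_quad {p : ℕ} (A : Matrix (Fin p) (Fin p) ℝ) (d y : Fin p → ℝ) :
    y ⬝ᵥ ((A * diagonal d * Aᵀ) *ᵥ y) = ∑ i, d i * (Aᵀ *ᵥ y) i ^ 2 := by
  rw [← mulVec_mulVec, ← mulVec_mulVec, dotProduct_mulVec, ← mulVec_transpose]
  simp only [dotProduct, mulVec_diagonal]
  exact Finset.sum_congr rfl fun i _ => by ring

lemma mcd_quad_one {p : ℕ} (A : Matrix (Fin p) (Fin p) ℝ) (y : Fin p → ℝ) :
    y ⬝ᵥ ((A * Aᵀ) *ᵥ y) = ∑ i, (Aᵀ *ᵥ y) i ^ 2 := by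
  have h := mcd_quad A (fun _ => 1) y
  simpa using h

lemma mcd_eig {p : ℕ} (S : Matrix (Fin p) (Fin p) ℝ) (hS : S.IsHermitian) :
    ∃ U : Matrix (Fin p) (Fin p) ℝ, U * Uᵀ = 1 ∧ S = U * diagonal hS.eigenvalues * Uᵀ := by
  refine ⟨hS.eigenvectorUnitary, ?_, ?_⟩
  · have := Unitary.coe_mul_star_self hS.eigenvectorUnitary
    rwa [Unitary.coe_star, star_eq_conjTranspose, conjTranspose_eq_transpose_of_trivial] at this
  · have := hS.spectral_theorem
    rw [Unitary.conjStarAlgAut_apply, star_eq_conjTranspose,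
      conjTranspose_eq_transpose_of_trivial] at this
    exact this

/-- Let `S` be a positive definite real `p × p` matrix whose eigenvalues all lie in
`[θ₁, θ₂]` with `0 < θ₁ ≤ θ₂`, and let `S = L * D * Lᵀ` be its modified Cholesky
decomposition.  Then every singular value `σ` of `L` satisfies
`√(θ₁/θ₂) ≤ σ ≤ √(θ₂/θ₁)`; that is, `θ₁/θ₂ • I ⪯ L * Lᵀ ⪯ θ₂/θ₁ • I` in the
Loewner order. -/
theorem mcd_factor_singular_value_bounds {p : ℕ}
    (S L D : Matrix (Fin p) (Fin p) ℝ) (θ₁ θ₂ : ℝ)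
    (hθ₁ : 0 < θ₁) (hθ : θ₁ ≤ θ₂)
    (hS : S.PosDef)
    (heig : ∀ i : Fin p, θ₁ ≤ hS.1.eigenvalues i ∧ hS.1.eigenvalues i ≤ θ₂)
    (hLlow : ∀ i j : Fin p, i < j → L i j = 0)
    (hLdiag : ∀ i : Fin p, L i i = 1)
    (hDoff : ∀ i j : Fin p, i ≠ j → D i j = 0)
    (hDpos : ∀ i : Fin p, 0 < D i i)
    (hdecomp : S = L * D * Lᵀ) :
    (L * Lᵀ - (θ₁ / θ₂) • (1 : Matrix (Fin p) (Fin p) ℝ)).PosSemidef ∧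
    ((θ₂ / θ₁) • (1 : Matrix (Fin p) (Fin p) ℝ) - L * Lᵀ).PosSemidef := by
  have hθ₂ : 0 < θ₂ := hθ₁.trans_le hθ
  have hD : D = diagonal (fun i => D i i) := by
    ext i j
    by_cases h : i = j
    · subst h; simp
    · rw [diagonal_apply_ne _ h, hDoff i j h]
  obtain ⟨U, hU, hSU⟩ := mcd_eig S hS.1
  have hn : ∀ y : Fin p → ℝ, ∑ i, (Uᵀ *ᵥ y) i ^ 2 = y ⬝ᵥ y := by
    intro y
    rw [← mcd_quad_one, hU, one_mulVec]
  have hlo : ∀ y : Fin p → ℝ, θ₁ * (y ⬝ᵥ y) ≤ y ⬝ᵥ (S *ᵥ y) := by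
    intro y
    have h : y ⬝ᵥ (S *ᵥ y) = _ := (congrArg (fun T => y ⬝ᵥ (T *ᵥ y)) hSU).trans (mcd_quad _ _ _)
    rw [h, ← hn, Finset.mul_sum]
    exact Finset.sum_le_sum fun i _ => mul_le_mul_of_nonneg_right (heig i).1 (sq_nonneg _)
  have hhi : ∀ y : Fin p → ℝ, y ⬝ᵥ (S *ᵥ y) ≤ θ₂ * (y ⬝ᵥ y) := by
    intro y
    have h : y ⬝ᵥ (S *ᵥ y) = _ := (congrArg (fun T => y ⬝ᵥ (T *ᵥ y)) hSU).trans (mcd_quad _ _ _)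
    rw [h, ← hn, Finset.mul_sum]
    exact Finset.sum_le_sum fun i _ => mul_le_mul_of_nonneg_right (heig i).2 (sq_nonneg _)
  have hq : ∀ y : Fin p → ℝ, y ⬝ᵥ (S *ᵥ y) = ∑ i, D i i * (Lᵀ *ᵥ y) i ^ 2 := by
    intro y
    rw [← mcd_quad, ← hD, ← hdecomp]
  have hd2 : ∀ i, D i i ≤ θ₂ := by
    intro i
    have h := hhi (Pi.single i 1)
    rw [hq] at h
    have h2 : D i i * (Lᵀ *ᵥ (Pi.single i 1)) i ^ 2 ≤
        ∑ k, D k k * (Lᵀ *ᵥ (Pi.single i 1)) k ^ 2 :=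
      Finset.single_le_sum (f := fun k => D k k * (Lᵀ *ᵥ (Pi.single i 1)) k ^ 2)
        (fun k _ => mul_nonneg (hDpos k).le (sq_nonneg _)) (Finset.mem_univ i)
    have h3 := h2.trans h
    simpa [hLdiag] using h3
  have hbt : BlockTriangular L OrderDual.toDual := fun i j hij => hLlow i j hij
  have hdet : L.det = 1 := by
    rw [det_of_isLowerTriangular L hbt]
    simp [hLdiag]
  have hu : IsUnit L.det := by rw [hdet]; exact isUnit_one
  have hinv : BlockTriangular L⁻¹ OrderDual.toDual := by
    haveI := invertibleOfIsUnitDet L hu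
    exact blockTriangular_inv_of_blockTriangular hbt
  have hinvd : ∀ i, L⁻¹ i i = 1 := by
    intro i
    have h : (L⁻¹ * L) i i = 1 := by rw [nonsing_inv_mul L hu, one_apply_eq]
    rw [mul_apply, Finset.sum_eq_single i, hLdiag, mul_one] at h
    · exact h
    · intro k _ hk
      rcases lt_or_gt_of_ne hk with h1 | h1
      · rw [hLlow k i h1, mul_zero]
      · have : L⁻¹ i k = 0 := hinv h1
        rw [this, zero_mul]
    · simp
  have hd1 : ∀ i, θ₁ ≤ D i i := by
    intro i
    have h := hlo (L⁻¹ i)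
    have hx : Lᵀ *ᵥ (L⁻¹ i) = Pi.single i 1 := by
      ext k
      rw [mulVec_transpose]
      have h1 : (L⁻¹ i ᵥ* L) k = (L⁻¹ * L) i k := rfl
      rw [h1, nonsing_inv_mul L hu, one_apply, Pi.single_apply]
      simp [eq_comm]
    rw [hq, hx, Finset.sum_eq_single i (by intro k _ hk; simp [hk]) (by simp)] at h
    have h2 : L⁻¹ i i * L⁻¹ i i ≤ L⁻¹ i ⬝ᵥ L⁻¹ i :=
      Finset.single_le_sum (f := fun k => L⁻¹ i k * L⁻¹ i k)
        (fun k _ => mul_self_nonneg _) (Finset.mem_univ i)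
    rw [hinvd] at h2
    simp only [Pi.single_eq_same] at h
    nlinarith
  have hLL : (L * Lᵀ).IsHermitian := by
    simp [IsHermitian, conjTranspose_eq_transpose_of_trivial]
  have hone : ∀ c : ℝ, (c • (1 : Matrix (Fin p) (Fin p) ℝ)).IsHermitian := by
    intro c
    simp [IsHermitian, conjTranspose_eq_transpose_of_trivial]
  constructor
  · refine .of_dotProduct_mulVec_nonneg (hLL.sub (hone _)) fun y => ?_
    have h1 : y ⬝ᵥ (S *ᵥ y) ≤ θ₂ * ∑ i, (Lᵀ *ᵥ y) i ^ 2 := by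
      rw [hq, Finset.mul_sum]
      exact Finset.sum_le_sum fun i _ => mul_le_mul_of_nonneg_right (hd2 i) (sq_nonneg _)
    have h2 := (hlo y).trans h1
    rw [star_trivial, sub_mulVec, dotProduct_sub, mcd_quad_one, smul_mulVec, one_mulVec,
      dotProduct_smul, smul_eq_mul, sub_nonneg, div_mul_eq_mul_div, div_le_iff₀ hθ₂]
    linarith
  · refine .of_dotProduct_mulVec_nonneg ((hone _).sub hLL) fun y => ?_
    have h1 : θ₁ * ∑ i, (Lᵀ *ᵥ y) i ^ 2 ≤ y ⬝ᵥ (S *ᵥ y) := by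
      rw [hq, Finset.mul_sum]
      exact Finset.sum_le_sum fun i _ => mul_le_mul_of_nonneg_right (hd1 i) (sq_nonneg _)
    have h2 := h1.trans (hhi y)
    rw [star_trivial, sub_mulVec, dotProduct_sub, mcd_quad_one, smul_mulVec, one_mulVec,
      dotProduct_smul, smul_eq_mul, sub_nonneg, div_mul_eq_mul_div, le_div_iff₀ hθ₁]
    linarith
end

section
/- Let ν > 0, τ > 0, and let Σ and Λ be real symmetric p×p matrices. Then the unique minimizer over symmetric Φ with Φ ⪰ νI of the function Φ ↦ −⟨Λ, Φ − Σ⟩ + (1/(2τ))‖Φ − Σ‖²_F is Φ* = (Σ + τΛ)₊. -/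
open Matrix

/-- The Frobenius norm of a real `p × p` matrix. -/
noncomputable def frobNorm {p : ℕ} (A : Matrix (Fin p) (Fin p) ℝ) : ℝ :=
  Real.sqrt (∑ i, ∑ j, (A i j) ^ 2)

/-- The trace inner product `⟨A, B⟩ = ∑ i j, A i j * B i j`. -/
def matInner {p : ℕ} (A B : Matrix (Fin p) (Fin p) ℝ) : ℝ :=
  ∑ i, ∑ j, A i j * B i j

lemma frob_sq {p : ℕ} (A : Matrix (Fin p) (Fin p) ℝ) : frobNorm A ^ 2 = matInner A A := by
  unfold frobNorm matInner
  have h : 0 ≤ ∑ i, ∑ j, (A i j) ^ 2 :=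
    Finset.sum_nonneg fun i _ => Finset.sum_nonneg fun j _ => sq_nonneg _
  refine (Real.sq_sqrt h).trans ?_
  exact Finset.sum_congr rfl fun i _ => Finset.sum_congr rfl fun j _ => sq (A i j)

lemma matInner_spec {p : ℕ} (D : Matrix (Fin p) (Fin p) ℝ) (c : Fin p → ℝ)
    (ξ : Fin p → (Fin p → ℝ)) :
    matInner D (∑ i, c i • Matrix.vecMulVec (ξ i) (ξ i)) = ∑ i, c i * (ξ i ⬝ᵥ (D *ᵥ ξ i)) := by
  simp only [matInner, Matrix.sum_apply, Matrix.smul_apply, Matrix.vecMulVec_apply, dotProduct,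
    Matrix.mulVec, Finset.mul_sum, smul_eq_mul]
  rw [Finset.sum_congr rfl fun i _ => Finset.sum_comm, Finset.sum_comm]
  refine Finset.sum_congr rfl fun k _ => Finset.sum_congr rfl fun i _ =>
    Finset.sum_congr rfl fun j _ => ?_
  ring

lemma spec_quad {p : ℕ} (c : Fin p → ℝ) (ξ : Fin p → (Fin p → ℝ)) (x : Fin p → ℝ) :
    x ⬝ᵥ ((∑ i, c i • Matrix.vecMulVec (ξ i) (ξ i)) *ᵥ x) = ∑ i, c i * (ξ i ⬝ᵥ x) ^ 2 := by
  rw [Matrix.sum_mulVec, dotProduct_sum]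
  refine Finset.sum_congr rfl fun i _ => ?_
  rw [Matrix.smul_mulVec, dotProduct_smul, Matrix.vecMulVec_mulVec, smul_eq_mul]
  simp [dotProduct_comm x (ξ i), sq]

lemma spec_one {p : ℕ} (ξ : Fin p → (Fin p → ℝ))
    (horth : ∀ i j : Fin p, ξ i ⬝ᵥ ξ j = if i = j then (1 : ℝ) else 0) :
    (1 : Matrix (Fin p) (Fin p) ℝ) = ∑ i, Matrix.vecMulVec (ξ i) (ξ i) := by
  have h : (Matrix.of ξ) * (Matrix.of ξ)ᵀ = 1 := by
    ext i j
    rw [Matrix.mul_apply, Matrix.one_apply, ← horth i j]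
    rfl
  rw [← mul_eq_one_comm.mp h]
  ext i j
  simp [Matrix.mul_apply, Matrix.sum_apply, Matrix.vecMulVec_apply]

lemma spec_symm {p : ℕ} (c : Fin p → ℝ) (ξ : Fin p → (Fin p → ℝ)) :
    (∑ i, c i • Matrix.vecMulVec (ξ i) (ξ i)).IsSymm := by
  ext i j
  simp [Matrix.sum_apply, Matrix.vecMulVec_apply, mul_comm]

lemma matInner_self_nonneg {p : ℕ} (A : Matrix (Fin p) (Fin p) ℝ) : 0 ≤ matInner A A :=
  Finset.sum_nonneg fun _ _ => Finset.sum_nonneg fun _ _ => mul_self_nonneg _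

lemma matInner_self_zero {p : ℕ} (A : Matrix (Fin p) (Fin p) ℝ) (h : matInner A A ≤ 0) :
    A = 0 := by
  have h0 := le_antisymm h (matInner_self_nonneg A)
  unfold matInner at h0
  have h2 := (Finset.sum_eq_zero_iff_of_nonneg
    (fun i _ => Finset.sum_nonneg fun j _ => mul_self_nonneg (A i j))).mp h0
  ext i j
  have h1 := (Finset.sum_eq_zero_iff_of_nonneg (fun j _ => mul_self_nonneg (A i j))).mp
    (h2 i (Finset.mem_univ _))
  exact mul_self_eq_zero.mp (h1 j (Finset.mem_univ _))

lemma f_diff {p : ℕ} (τ : ℝ) (hτ : 0 < τ) (S L A B : Matrix (Fin p) (Fin p) ℝ) :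
    (-(matInner L (A - S)) + (1 / (2 * τ)) * matInner (A - S) (A - S))
      - (-(matInner L (B - S)) + (1 / (2 * τ)) * matInner (B - S) (B - S))
    = (1 / (2 * τ)) * (matInner (A - B) (A - B) + 2 * matInner (A - B) (B - (S + τ • L))) := by
  simp only [matInner, Finset.mul_sum, ← Finset.sum_add_distrib, ← Finset.sum_sub_distrib,
    ← Finset.sum_neg_distrib]
  refine Finset.sum_congr rfl fun i _ => Finset.sum_congr rfl fun j _ => ?_
  simp only [Matrix.sub_apply, Matrix.add_apply, Matrix.smul_apply, smul_eq_mul]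
  field_simp
  ring

/-- Let `ν > 0`, `τ > 0`, and let `S` (= Σ) and `Lam` (= Λ) be real symmetric `p × p`
matrices, and let `S + τ • Lam = ∑ i, mu i • ξ i (ξ i)ᵀ` be an orthonormal spectral
decomposition.  Then the unique minimizer over symmetric `Φ ⪰ νI` of
`Φ ↦ −⟨Lam, Φ − S⟩ + (1/(2τ))‖Φ − S‖²_F` is `Φ* = (S + τ Lam)₊`, the eigenvalue
clipping of `S + τ • Lam` at level `ν`. -/
theorem phi_step_minimizer {p : ℕ} (ν τ : ℝ) (hν : 0 < ν) (hτ : 0 < τ)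
    (S Lam : Matrix (Fin p) (Fin p) ℝ) (hS : S.IsSymm) (hLam : Lam.IsSymm)
    (mu : Fin p → ℝ) (ξ : Fin p → (Fin p → ℝ))
    (horth : ∀ i j : Fin p, ξ i ⬝ᵥ ξ j = if i = j then (1 : ℝ) else 0)
    (hdecomp : S + τ • Lam = ∑ i, mu i • Matrix.vecMulVec (ξ i) (ξ i)) :
    let Φstar : Matrix (Fin p) (Fin p) ℝ :=
      ∑ i, max (mu i) ν • Matrix.vecMulVec (ξ i) (ξ i)
    let f : Matrix (Fin p) (Fin p) ℝ → ℝ :=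
      fun Φ => -(matInner Lam (Φ - S)) + (1 / (2 * τ)) * (frobNorm (Φ - S)) ^ 2
    Φstar.IsSymm ∧ (Φstar - ν • (1 : Matrix (Fin p) (Fin p) ℝ)).PosSemidef ∧
    (∀ Φ : Matrix (Fin p) (Fin p) ℝ, Φ.IsSymm →
      (Φ - ν • (1 : Matrix (Fin p) (Fin p) ℝ)).PosSemidef → f Φstar ≤ f Φ) ∧
    (∀ Φ : Matrix (Fin p) (Fin p) ℝ, Φ.IsSymm →
      (Φ - ν • (1 : Matrix (Fin p) (Fin p) ℝ)).PosSemidef → f Φ = f Φstar → Φ = Φstar) := by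
  intro Φstar f
  have key : ∀ Φ : Matrix (Fin p) (Fin p) ℝ,
      (Φ - ν • (1 : Matrix (Fin p) (Fin p) ℝ)).PosSemidef →
      (1 / (2 * τ)) * matInner (Φ - Φstar) (Φ - Φstar) ≤ f Φ - f Φstar := by
    intro Φ hΦ
    have e : Φstar - (S + τ • Lam)
        = ∑ i, (max (mu i) ν - mu i) • Matrix.vecMulVec (ξ i) (ξ i) := by
      rw [hdecomp]
      simp only [Φstar, sub_smul, Finset.sum_sub_distrib]
    have h2 : 0 ≤ matInner (Φ - Φstar) (Φstar - (S + τ • Lam)) := by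
      rw [e, matInner_spec]
      refine Finset.sum_nonneg fun i _ => ?_
      have h3 : ξ i ⬝ᵥ (Φstar *ᵥ ξ i) = max (mu i) ν := by
        simp only [Φstar]
        rw [spec_quad]
        simp [horth]
      have h4 : ν ≤ ξ i ⬝ᵥ (Φ *ᵥ ξ i) := by
        have := hΦ.dotProduct_mulVec_nonneg (ξ i)
        rw [Matrix.sub_mulVec, Matrix.smul_mulVec, Matrix.one_mulVec, dotProduct_sub,
          dotProduct_smul] at this
        simp only [star_trivial, horth, if_true, smul_eq_mul, mul_one] at this
        linarith
      rw [Matrix.sub_mulVec, dotProduct_sub, h3]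
      rcases le_total (mu i) ν with h | h
      · rw [max_eq_right h]
        exact mul_nonneg (by linarith) (by linarith)
      · simp [max_eq_left h]
    simp only [f, frob_sq]
    rw [f_diff τ hτ]
    have : 0 < 1 / (2 * τ) := by positivity
    exact mul_le_mul_of_nonneg_left (by linarith) this.le
  have hpos : 0 < 1 / (2 * τ) := by positivity
  refine ⟨spec_symm _ _, ?_, ?_, ?_⟩
  · have e : Φstar - ν • (1 : Matrix (Fin p) (Fin p) ℝ)
        = ∑ i, (max (mu i) ν - ν) • Matrix.vecMulVec (ξ i) (ξ i) := by
      rw [spec_one ξ horth]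
      simp only [Φstar, sub_smul, Finset.sum_sub_distrib, Finset.smul_sum]
    rw [e]
    refine Matrix.PosSemidef.of_dotProduct_mulVec_nonneg ?_ fun x => ?_
    · rw [Matrix.IsHermitian, Matrix.conjTranspose_eq_transpose_of_trivial]
      exact spec_symm _ _
    · rw [star_trivial, spec_quad]
      exact Finset.sum_nonneg fun i _ =>
        mul_nonneg (sub_nonneg.mpr (le_max_right _ _)) (sq_nonneg _)
  · intro Φ _ hΦ
    have := key Φ hΦ
    have := mul_nonneg hpos.le (matInner_self_nonneg (Φ - Φstar))
    linarith
  · intro Φ _ hΦ hf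
    have h := key Φ hΦ
    rw [hf, sub_self] at h
    exact sub_eq_zero.mp (matInner_self_zero _ (nonpos_of_mul_nonpos_right h hpos))
end

section
/- Let λ ≥ 0, ν > 0, τ > 0, let Σ̂₁, …, Σ̂_M be real symmetric p×p matrices with average Σ̄, and let (Σⁱ, Φⁱ, Λⁱ), i = 0, 1, 2, …, be any sequence of real symmetric p×p matrices satisfying the ADMM updates Φ^{i+1} = (Σⁱ + τΛⁱ)₊, Σ^{i+1} = s(τ(Σ̄ − Λⁱ) + Φ^{i+1}, λτ)/(τ + 1), Λ^{i+1} = Λⁱ − (1/τ)(Φ^{i+1} − Σ^{i+1}). Then for every i ≥ 1, ⟨Σⁱ − Σ^{i+1}, Λ^{i+1} − Λⁱ⟩ ≥ ‖Σ^{i+1} − Σⁱ‖²_F, and in particular ⟨Σⁱ − Σ^{i+1}, Λ^{i+1} − Λⁱ⟩ ≥ 0. -/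
open Matrix Filter Topology

/-- The L1 norm of the off-diagonal entries: `|Σ|₁ = ∑_{i ≠ j} |σ_{ij}|`. -/
noncomputable def offDiagL1 {p : ℕ} (A : Matrix (Fin p) (Fin p) ℝ) : ℝ :=
  ∑ i, ∑ j, if i = j then 0 else |A i j|

/-- The elementwise soft-threshold operator: off the diagonal
`s(z, δ) = sign(z) * max(|z| − δ, 0)`, and the diagonal is left unchanged. -/
noncomputable def softThresh {p : ℕ} (Z : Matrix (Fin p) (Fin p) ℝ) (δ : ℝ) :
    Matrix (Fin p) (Fin p) ℝ :=
  Matrix.of fun i j =>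
    if i = j then Z i j else Real.sign (Z i j) * max (|Z i j| - δ) 0

/-- `IsClip ν Z W` says that `W = (Z)₊`: there is an orthonormal spectral decomposition
`Z = ∑ i, lam i • ξ i (ξ i)ᵀ` such that `W = ∑ i, max (lam i) ν • ξ i (ξ i)ᵀ`
(the eigenvalue-clipping of `Z` at level `ν`). -/
def IsClip {p : ℕ} (ν : ℝ) (Z W : Matrix (Fin p) (Fin p) ℝ) : Prop :=
  ∃ (lam : Fin p → ℝ) (ξ : Fin p → (Fin p → ℝ)),
    (∀ i j : Fin p, ξ i ⬝ᵥ ξ j = if i = j then (1 : ℝ) else 0) ∧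
    Z = ∑ i, lam i • Matrix.vecMulVec (ξ i) (ξ i) ∧
    W = ∑ i, max (lam i) ν • Matrix.vecMulVec (ξ i) (ξ i)

/-- The squared `J`-norm of a pair `(Λ, Σ)`: `‖(Λ, Σ)‖²_J = τ‖Λ‖²_F + τ⁻¹‖Σ‖²_F`. -/
noncomputable def JnormSq {p : ℕ} (τ : ℝ) (L S : Matrix (Fin p) (Fin p) ℝ) : ℝ :=
  τ * (frobNorm L) ^ 2 + τ⁻¹ * (frobNorm S) ^ 2

lemma soft_cases (z d : ℝ) (hd : 0 ≤ d) :
    (d ≤ z ∧ Real.sign z * max (|z| - d) 0 = z - d) ∨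
    (z ≤ -d ∧ Real.sign z * max (|z| - d) 0 = z + d) ∨
    (-d ≤ z ∧ z ≤ d ∧ Real.sign z * max (|z| - d) 0 = 0) := by
  by_cases h : |z| ≤ d
  · right; right
    rw [max_eq_right (by linarith)]
    exact ⟨(abs_le.mp h).1, (abs_le.mp h).2, by simp⟩
  · push Not at h
    rw [max_eq_left (by linarith)]
    rcases lt_trichotomy z 0 with hz | hz | hz
    · right; left
      rw [abs_of_neg hz] at *
      rw [Real.sign_of_neg hz]
      constructor <;> linarith
    · subst hz
      simp at h
      linarith
    · left
      rw [abs_of_pos hz] at *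
      rw [Real.sign_of_pos hz]
      constructor <;> linarith

lemma soft_firm (a b d : ℝ) (hd : 0 ≤ d) :
    0 ≤ (Real.sign a * max (|a| - d) 0 - Real.sign b * max (|b| - d) 0) *
      ((a - Real.sign a * max (|a| - d) 0) - (b - Real.sign b * max (|b| - d) 0)) := by
  rcases soft_cases a d hd with ⟨h1, e⟩ | ⟨h1, e⟩ | ⟨h1, h2, e⟩ <;>
  rcases soft_cases b d hd with ⟨k1, f⟩ | ⟨k1, f⟩ | ⟨k1, k2, f⟩ <;>
  rw [e, f] <;>
  first
  | exact mul_nonneg (by linarith) (by linarith)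
  | (ring_nf; exact le_refl _)
  | exact mul_nonneg_of_nonpos_of_nonpos (by linarith) (by linarith)

lemma soft_step (t s s' l l' c z z' : ℝ) (ht : 0 < t)
    (hz : z = t * c - t * l + s) (hz' : z' = t * c - t * l' + s')
    (h : 0 ≤ ((t + 1) * s - (t + 1) * s') *
      ((z - (t + 1) * s) - (z' - (t + 1) * s'))) :
    (s' - s) ^ 2 ≤ (s - s') * (l' - l) := by
  subst hz hz'
  have h2 : 0 ≤ (t * (t + 1)) * ((s - s') * (l' - l) - (s' - s) ^ 2) := by
    convert h using 1; ring
  have := nonneg_of_mul_nonneg_right h2 (by positivity)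
  linarith

/-- For any ADMM sequence (symmetric matrices satisfying the updates
`Φ^{i+1} = (Σⁱ + τΛⁱ)₊`, `Σ^{i+1} = s(τ(Σ̄ − Λⁱ) + Φ^{i+1}, λτ)/(τ+1)`,
`Λ^{i+1} = Λⁱ − (1/τ)(Φ^{i+1} − Σ^{i+1})`), for every `i ≥ 1` one has
`⟨Σⁱ − Σ^{i+1}, Λ^{i+1} − Λⁱ⟩ ≥ ‖Σ^{i+1} − Σⁱ‖²_F ≥ 0`. -/
theorem admm_successive_inner_nonneg {p M : ℕ} (hM : 0 < M)
    (lam ν τ : ℝ) (hlam : 0 ≤ lam) (hν : 0 < ν) (hτ : 0 < τ)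
    (Sighat : Fin M → Matrix (Fin p) (Fin p) ℝ) (hsymm : ∀ k, (Sighat k).IsSymm)
    (Sig Phi Lam : ℕ → Matrix (Fin p) (Fin p) ℝ)
    (hseq : ∀ i, (Sig i).IsSymm ∧ (Phi i).IsSymm ∧ (Lam i).IsSymm)
    (hPhiStep : ∀ i, IsClip ν (Sig i + τ • Lam i) (Phi (i + 1)))
    (hSigStep : ∀ i, Sig (i + 1) = (τ + 1)⁻¹ •
      softThresh (τ • ((M : ℝ)⁻¹ • ∑ k, Sighat k - Lam i) + Phi (i + 1)) (lam * τ))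
    (hLamStep : ∀ i, Lam (i + 1) = Lam i - τ⁻¹ • (Phi (i + 1) - Sig (i + 1))) :
    ∀ i, 1 ≤ i →
      matInner (Sig i - Sig (i + 1)) (Lam (i + 1) - Lam i) ≥
        (frobNorm (Sig (i + 1) - Sig i)) ^ 2 ∧
      matInner (Sig i - Sig (i + 1)) (Lam (i + 1) - Lam i) ≥ 0 := by
  intro i hi
  obtain ⟨n, rfl⟩ : ∃ n, i = n + 1 := ⟨i - 1, by omega⟩
  have hfrob : (frobNorm (Sig (n + 1 + 1) - Sig (n + 1))) ^ 2 =
      ∑ a, ∑ b, ((Sig (n + 1 + 1) - Sig (n + 1)) a b) ^ 2 :=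
    Real.sq_sqrt (Finset.sum_nonneg fun a _ => Finset.sum_nonneg fun b _ => sq_nonneg _)
  have main : matInner (Sig (n + 1) - Sig (n + 1 + 1)) (Lam (n + 1 + 1) - Lam (n + 1)) ≥
      (frobNorm (Sig (n + 1 + 1) - Sig (n + 1))) ^ 2 := by
    rw [hfrob]
    refine Finset.sum_le_sum fun a _ => Finset.sum_le_sum fun b _ => ?_
    simp only [Matrix.sub_apply]
    have key : ∀ m, (τ • ((M : ℝ)⁻¹ • ∑ k, Sighat k - Lam m) + Phi (m + 1)) a b =
        τ * ((M : ℝ)⁻¹ • ∑ k, Sighat k) a b - τ * Lam (m + 1) a b + Sig (m + 1) a b := by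
      intro m
      rw [hLamStep m]
      simp only [Matrix.add_apply, Matrix.sub_apply, Matrix.smul_apply, smul_eq_mul]
      field_simp
      ring
    have hs : ∀ m, (τ + 1) * Sig (m + 1) a b =
        softThresh (τ • ((M : ℝ)⁻¹ • ∑ k, Sighat k - Lam m) + Phi (m + 1)) (lam * τ) a b := by
      intro m
      conv_lhs => rw [hSigStep m]
      rw [Matrix.smul_apply, smul_eq_mul, mul_inv_cancel_left₀ (by positivity)]
    refine soft_step τ _ _ _ _ _ _ _ hτ (key n) (key (n + 1)) ?_
    rw [hs n, hs (n + 1)]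
    simp only [softThresh, Matrix.of_apply]
    split_ifs with hab
    · simp
    · exact soft_firm _ _ _ (by positivity)
  exact ⟨main, le_trans (sq_nonneg _) main⟩
end

section
/- Let λ ≥ 0, ν > 0, τ > 0, let Σ̂₁, …, Σ̂_M be real symmetric p×p matrices with average Σ̄, and let (Σⁱ, Φⁱ, Λⁱ) be a sequence of real symmetric p×p matrices following the ADMM updates Φ^{i+1} = (Σⁱ + τΛⁱ)₊, Σ^{i+1} = s(τ(Σ̄ − Λⁱ) + Φ^{i+1}, λτ)/(τ + 1), Λ^{i+1} = Λⁱ − (1/τ)(Φ^{i+1} − Σ^{i+1}). Suppose (Σ̂⁺, Φ̂⁺, Λ̂⁺) are symmetric matrices satisfying the KKT conditions: Φ̂⁺ = Σ̂⁺, Φ̂⁺ ⪰ νI, ⟨Λ̂⁺, Φ − Φ̂⁺⟩ ≤ 0 for all symmetric Φ ⪰ νI, (Σ̂⁺ − Σ̄)_{jj} + Λ̂⁺_{jj} = 0 for all j, and for all j ≠ l the entry (−Σ̂⁺ + Σ̄ − Λ̂⁺)_{jl} belongs to λ·∂|Σ̂⁺_{jl}| (i.e., it equals λ·sign(Σ̂⁺_{jl})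 if Σ̂⁺_{jl} ≠ 0 and has absolute value at most λ otherwise). Then for every i ≥ 1, ‖W⁺ − Wⁱ‖²_J − ‖W⁺ − W^{i+1}‖²_J ≥ ‖Wⁱ − W^{i+1}‖²_J, where W⁺ = (Λ̂⁺, Σ̂⁺), Wⁱ = (Λⁱ, Σⁱ), and ‖(Λ, Σ)‖²_J = τ‖Λ‖²_F + τ^{−1}‖Σ‖²_F. -/
open Matrix Filter Topology

theorem frobNorm_sq {p : ℕ} (A : Matrix (Fin p) (Fin p) ℝ) :
    frobNorm A ^ 2 = ∑ i, ∑ j, (A i j) ^ 2 := by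
  unfold frobNorm
  exact Real.sq_sqrt (Finset.sum_nonneg fun i _ => Finset.sum_nonneg fun j _ => sq_nonneg _)

theorem matInner_vec {p : ℕ} (v : Fin p → ℝ) (B : Matrix (Fin p) (Fin p) ℝ) :
    matInner (vecMulVec v v) B = v ⬝ᵥ (B *ᵥ v) := by
  simp only [matInner, vecMulVec_apply, dotProduct, mulVec, Finset.mul_sum]
  refine Finset.sum_congr rfl fun i _ => Finset.sum_congr rfl fun j _ => by ring

theorem matInner_sum_left {p : ℕ} (c : Fin p → ℝ) (A : Fin p → Matrix (Fin p) (Fin p) ℝ)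
    (B : Matrix (Fin p) (Fin p) ℝ) :
    matInner (∑ k, c k • A k) B = ∑ k, c k * matInner (A k) B := by
  simp only [matInner, Matrix.sum_apply, Matrix.smul_apply, smul_eq_mul, Finset.sum_mul,
    Finset.mul_sum]
  conv_rhs => rw [Finset.sum_comm]
  refine Finset.sum_congr rfl fun i _ => ?_
  conv_rhs => rw [Finset.sum_comm]
  refine Finset.sum_congr rfl fun j _ => Finset.sum_congr rfl fun k _ => by ring

theorem sum_vec_one {p : ℕ} (ξ : Fin p → (Fin p → ℝ))
    (h : ∀ i j : Fin p, ξ i ⬝ᵥ ξ j = if i = j then (1 : ℝ) else 0) :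
    ∑ i, vecMulVec (ξ i) (ξ i) = (1 : Matrix (Fin p) (Fin p) ℝ) := by
  have h1 : (Matrix.of ξ) * (Matrix.of ξ)ᵀ = 1 := by
    ext i j
    have := h i j
    simp only [dotProduct] at this
    simp [Matrix.mul_apply, Matrix.one_apply, this]
  have h2 := mul_eq_one_comm.mp h1
  rw [← h2]
  ext i j
  simp [Matrix.mul_apply, Matrix.sum_apply, vecMulVec_apply]

theorem clip_feas {p : ℕ} {ν : ℝ} {Z W : Matrix (Fin p) (Fin p) ℝ} (h : IsClip ν Z W) :
    (W - ν • (1 : Matrix (Fin p) (Fin p) ℝ)).PosSemidef := by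
  obtain ⟨l, ξ, ho, -, rfl⟩ := h
  rw [← sum_vec_one ξ ho, Finset.smul_sum, ← Finset.sum_sub_distrib]
  refine Matrix.posSemidef_sum _ fun i _ => ?_
  rw [← sub_smul]
  have := (Matrix.posSemidef_vecMulVec_self_star (ξ i)).smul
    (sub_nonneg.mpr (le_max_right (l i) ν))
  simpa using this

theorem clip_var {p : ℕ} {ν : ℝ} {Z W : Matrix (Fin p) (Fin p) ℝ} (h : IsClip ν Z W)
    (F : Matrix (Fin p) (Fin p) ℝ)
    (hF : (F - ν • (1 : Matrix (Fin p) (Fin p) ℝ)).PosSemidef) :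
    matInner (Z - W) (F - W) ≤ 0 := by
  obtain ⟨l, ξ, ho, hZ, hW⟩ := h
  have e : Z - W = ∑ i, (l i - max (l i) ν) • vecMulVec (ξ i) (ξ i) := by
    rw [hZ, hW, ← Finset.sum_sub_distrib]
    simp only [sub_smul]
  rw [e, matInner_sum_left]
  refine Finset.sum_nonpos fun i _ => ?_
  rw [matInner_vec, Matrix.sub_mulVec, dotProduct_sub]
  have hw : ξ i ⬝ᵥ (W *ᵥ ξ i) = max (l i) ν := by
    rw [hW, Matrix.sum_mulVec, dotProduct_sum]
    simp only [Matrix.smul_mulVec, vecMulVec_mulVec, dotProduct_smul, ho]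
    simp [ho]
  have hf : ν ≤ ξ i ⬝ᵥ (F *ᵥ ξ i) := by
    have := hF.dotProduct_mulVec_nonneg (ξ i)
    rw [Matrix.sub_mulVec, dotProduct_sub] at this
    simp [Matrix.smul_mulVec, ho] at this
    linarith
  rw [hw]
  rcases le_total (l i) ν with h | h
  · rw [max_eq_right h]
    exact mul_nonpos_of_nonpos_of_nonneg (by linarith) (by linarith)
  · rw [max_eq_left h]; simp

/-- `g ∈ w ∂|x|`. -/
def IsSub (w g x : ℝ) : Prop := |g| ≤ w ∧ g * x = w * |x|

theorem IsSub.mono {w g x g' x' : ℝ} (h : IsSub w g x) (h' : IsSub w g' x') :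
    0 ≤ (g - g') * (x - x') := by
  obtain ⟨a, b⟩ := h
  obtain ⟨c, d⟩ := h'
  have e1 : g * x' ≤ w * |x'| :=
    (le_abs_self _).trans (by rw [abs_mul]; exact mul_le_mul_of_nonneg_right a (abs_nonneg _))
  have e2 : g' * x ≤ w * |x| :=
    (le_abs_self _).trans (by rw [abs_mul]; exact mul_le_mul_of_nonneg_right c (abs_nonneg _))
  nlinarith

theorem soft_sub {lam τ z x g : ℝ} (hlam : 0 ≤ lam) (hτ : 0 < τ)
    (hx : x = (τ + 1)⁻¹ * (Real.sign z * max (|z| - lam * τ) 0))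
    (hg : τ * g = z - (τ + 1) * x) : IsSub lam g x := by
  have ht : 0 < τ + 1 := by linarith
  have hx' : (τ + 1) * x = Real.sign z * max (|z| - lam * τ) 0 := by
    rw [hx]; field_simp
  have hlt : 0 ≤ lam * τ := by positivity
  rcases le_or_gt |z| (lam * τ) with h | h
  · rw [max_eq_right (by linarith), mul_zero] at hx'
    have x0 : x = 0 := by
      rcases mul_eq_zero.mp hx' with h | h
      · linarith
      · exact h
    subst x0
    refine ⟨?_, by simp⟩
    have : z = τ * g := by linarith
    rw [this, abs_mul, abs_of_pos hτ] at h
    nlinarith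
  · rw [max_eq_left (by linarith)] at hx'
    rcases lt_trichotomy z 0 with hz | hz | hz
    · rw [Real.sign_of_neg hz] at hx'
      rw [abs_of_neg hz] at hx' h
      have hxn : x < 0 := by
        by_contra hc
        push Not at hc
        have := mul_nonneg ht.le hc
        linarith
      have : g = -lam := by
        have : τ * g = τ * (-lam) := by linarith
        exact mul_left_cancel₀ hτ.ne' this
      rw [this]
      refine ⟨by rw [abs_neg, abs_of_nonneg hlam], by rw [abs_of_neg hxn]; ring⟩
    · subst hz; simp at h; linarith
    · rw [Real.sign_of_pos hz] at hx'
      rw [abs_of_pos hz] at hx' h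
      have hxn : 0 < x := by
        by_contra hc
        push Not at hc
        have := mul_nonpos_of_nonneg_of_nonpos ht.le hc
        linarith
      have : g = lam := by
        have : τ * g = τ * lam := by linarith
        exact mul_left_cancel₀ hτ.ne' this
      rw [this]
      refine ⟨by rw [abs_of_nonneg hlam], by rw [abs_of_pos hxn]⟩

/-- **Monotonicity lemma for the ADMM iterates (Lemma 1).**  If `(Σ̂⁺, Φ̂⁺, Λ̂⁺)` is a
KKT point of the constrained ensemble problem, then for every `i ≥ 1`,
`‖W⁺ − Wⁱ‖²_J − ‖W⁺ − W^{i+1}‖²_J ≥ ‖Wⁱ − W^{i+1}‖²_J`, where `W⁺ = (Λ̂⁺, Σ̂⁺)`,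
`Wⁱ = (Λⁱ, Σⁱ)` and `‖(Λ, Σ)‖²_J = τ‖Λ‖²_F + τ⁻¹‖Σ‖²_F`. -/
theorem admm_J_norm_monotone {p M : ℕ} (hM : 0 < M)
    (lam ν τ : ℝ) (hlam : 0 ≤ lam) (hν : 0 < ν) (hτ : 0 < τ)
    (Sighat : Fin M → Matrix (Fin p) (Fin p) ℝ) (hsymm : ∀ k, (Sighat k).IsSymm)
    (Sig Phi Lam : ℕ → Matrix (Fin p) (Fin p) ℝ)
    (hseq : ∀ i, (Sig i).IsSymm ∧ (Phi i).IsSymm ∧ (Lam i).IsSymm)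
    (hPhiStep : ∀ i, IsClip ν (Sig i + τ • Lam i) (Phi (i + 1)))
    (hSigStep : ∀ i, Sig (i + 1) = (τ + 1)⁻¹ •
      softThresh (τ • ((M : ℝ)⁻¹ • ∑ k, Sighat k - Lam i) + Phi (i + 1)) (lam * τ))
    (hLamStep : ∀ i, Lam (i + 1) = Lam i - τ⁻¹ • (Phi (i + 1) - Sig (i + 1)))
    -- the KKT point `(Σ̂⁺, Φ̂⁺, Λ̂⁺)`
    (Sigp Phip Lamp : Matrix (Fin p) (Fin p) ℝ)
    (hSigpSymm : Sigp.IsSymm) (hPhipSymm : Phip.IsSymm) (hLampSymm : Lamp.IsSymm)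
    (hPrimal : Phip = Sigp)
    (hFeas : (Phip - ν • (1 : Matrix (Fin p) (Fin p) ℝ)).PosSemidef)
    (hDual : ∀ Φ : Matrix (Fin p) (Fin p) ℝ, Φ.IsSymm →
      (Φ - ν • (1 : Matrix (Fin p) (Fin p) ℝ)).PosSemidef → matInner Lamp (Φ - Phip) ≤ 0)
    (hStatDiag : ∀ j : Fin p, (Sigp - (M : ℝ)⁻¹ • ∑ k, Sighat k) j j + Lamp j j = 0)
    (hStatOff : ∀ j l : Fin p, j ≠ l →
      if Sigp j l ≠ 0 then
        (-Sigp + (M : ℝ)⁻¹ • ∑ k, Sighat k - Lamp) j l = lam * Real.sign (Sigp j l)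
      else |(-Sigp + (M : ℝ)⁻¹ • ∑ k, Sighat k - Lamp) j l| ≤ lam) :
    ∀ i, 1 ≤ i →
      JnormSq τ (Lamp - Lam i) (Sigp - Sig i) -
          JnormSq τ (Lamp - Lam (i + 1)) (Sigp - Sig (i + 1)) ≥
        JnormSq τ (Lam i - Lam (i + 1)) (Sig i - Sig (i + 1)) := by
  intro i hi
  set B : Matrix (Fin p) (Fin p) ℝ := (M : ℝ)⁻¹ • ∑ k, Sighat k with hB
  have hsub : ∀ n j l, IsSub (if j = l then 0 else lam)
      (B j l - Lam (n+1) j l - Sig (n+1) j l) (Sig (n+1) j l) := by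
    intro n j l
    have hS := congrFun (congrFun (hSigStep n) j) l
    have hL := congrFun (congrFun (hLamStep n) j) l
    simp only [softThresh, Matrix.smul_apply, Matrix.of_apply, smul_eq_mul, Matrix.add_apply,
      Matrix.sub_apply] at hS hL
    have hL' : τ * Lam (n+1) j l = τ * Lam n j l - (Phi (n+1) j l - Sig (n+1) j l) := by
      rw [hL]; field_simp
    by_cases hjl : j = l
    · simp only [hjl, if_true] at hS hL' ⊢
      have hS' : (τ + 1) * Sig (n+1) l l = τ * (B l l - Lam n l l) + Phi (n+1) l l := by
        rw [hS]; field_simp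
      have : τ * (B l l - Lam (n+1) l l - Sig (n+1) l l) = 0 := by linarith
      rcases mul_eq_zero.mp this with h | h
      · linarith
      · rw [h]; simp [IsSub]
    · simp only [hjl, if_false] at hS ⊢
      exact soft_sub hlam hτ hS (by linarith)
  have hsubp : ∀ j l, IsSub (if j = l then 0 else lam)
      (B j l - Lamp j l - Sigp j l) (Sigp j l) := by
    intro j l
    by_cases hjl : j = l
    · subst hjl
      have := hStatDiag j
      simp only [Matrix.sub_apply] at this
      have h : B j j - Lamp j j - Sigp j j = 0 := by linarith
      rw [h]; simp [IsSub]
    · have := hStatOff j l hjl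
      simp only [hjl, if_false]
      have e : (-Sigp + B - Lamp) j l = B j l - Lamp j l - Sigp j l := by
        simp only [Matrix.sub_apply, Matrix.add_apply, Matrix.neg_apply]; ring
      rw [e] at this
      split_ifs at this with h
      · rw [this]
        rcases lt_or_gt_of_ne h with h | h
        · rw [Real.sign_of_neg h]
          exact ⟨by simp [abs_of_nonneg hlam], by rw [abs_of_neg h]; ring⟩
        · rw [Real.sign_of_pos h]
          exact ⟨by simp [abs_of_nonneg hlam], by rw [abs_of_pos h]; ring⟩
      · push Not at h
        exact ⟨this, by rw [h]; simp⟩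
  obtain ⟨n, rfl⟩ : ∃ n, i = n + 1 := ⟨i - 1, by omega⟩
  have h1 := clip_var (hPhiStep (n+1)) Phip hFeas
  have h2 := hDual _ (hseq (n+1+1)).2.1 (clip_feas (hPhiStep (n+1)))
  rw [hPrimal] at h1 h2
  simp only [matInner, Matrix.sub_apply, Matrix.add_apply, Matrix.smul_apply, smul_eq_mul] at h1 h2
  simp only [JnormSq, frobNorm_sq, Matrix.sub_apply]
  rw [ge_iff_le, ← sub_nonneg]
  have key : 0 ≤ -2 * τ⁻¹ * ((∑ j, ∑ l, (Sig (n+1) j l + τ * Lam (n+1) j l - Phi (n+1+1) j l) *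
      (Sigp j l - Phi (n+1+1) j l)) +
      τ * ∑ j, ∑ l, Lamp j l * (Phi (n+1+1) j l - Sigp j l)) := by
    have := mul_nonpos_of_nonneg_of_nonpos hτ.le h2
    have h3 : 0 < τ⁻¹ := inv_pos.mpr hτ
    nlinarith
  refine key.trans ?_
  simp only [Finset.mul_sum, ← Finset.sum_add_distrib, ← Finset.sum_sub_distrib]
  refine Finset.sum_le_sum fun j _ => Finset.sum_le_sum fun l _ => ?_
  have m1 := (hsub n j l).mono (hsub (n+1) j l)
  have m2 := (hsub (n+1) j l).mono (hsubp j l)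
  have hL := congrFun (congrFun (hLamStep (n+1)) j) l
  simp only [Matrix.smul_apply, smul_eq_mul, Matrix.sub_apply] at hL
  have hP : Phi (n+1+1) j l = Sig (n+1+1) j l + τ * (Lam (n+1) j l - Lam (n+1+1) j l) := by
    rw [hL]; field_simp; ring
  rw [hP]
  generalize Sig (n+1+1) j l = S' at *
  generalize Sig (n+1) j l = S at *
  generalize Lam (n+1+1) j l = L' at *
  generalize Lam (n+1) j l = L at *
  generalize Sigp j l = Sp at *
  generalize Lamp j l = Lp at *
  have m1' : (S - S') * (L - L') ≤ 0 := by nlinarith [sq_nonneg (S - S')]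
  have m2' : (Lp - L') * (Sp - S') ≤ 0 := by nlinarith [sq_nonneg (Sp - S')]
  have ht : τ⁻¹ * τ = 1 := inv_mul_cancel₀ hτ.ne'
  generalize τ⁻¹ = t at *
  clear key h1 h2
  have E : t * τ * τ = τ := by rw [ht, one_mul]
  rw [← sub_nonneg]
  have : 0 ≤ -2 * ((S - S') * (L - L')) - 2 * ((Lp - L') * (Sp - S')) := by linarith
  refine this.trans (le_of_eq ?_)
  linear_combination (-2 * ((S - S') * (L - L')) - 2 * ((Lp - L') * (Sp - S')) + 2 * τ * (Lp - L') * (L - L')) * (-1) * ht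
end
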